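/- Let Q be a finite type, Θ a probability distribution on Q, and f : Q × Q → ℝ with f(x,y) ∈ {−1,1} for all x, y. Let P be a probability distribution on Q × Q (the law of (X₁,X₂)) and R a probability distribution on Q × Q (the law of (Y₁,Y₂)), with (X₁,X₂) independent of (Y₁,Y₂), and suppose for real C_X, C_Y ≥ 0 that P(x₁,x₂) ≤ 2^{C_X} Θ(x₁) Θ(x₂) for all x₁, x₂ and R(y₁,y₂) ≤ 2^{C_Y} Θ(y₁) Θ(y₂) for all y₁, y₂. Then for every C > 0, |Σ_{x₁,x₂,y₁,y₂} P(x₁,x₂) R(y₁,y₂) f(x₁,y₁) f(x₂,y₂)| ≤ 2^{C_X + C_Y + 2C} · Disc_Θ(f) + 2 · 2^{−C}. -/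

import Mathlib

/-- The discrepancy of `f` with respect to the distribution `Θ`: the maximum over all
pairs of subsets `A, B` of `|∑_{x∈A} ∑_{y∈B} Θ x * Θ y * f x y|`. -/
noncomputable def disc {Q : Type*} [Fintype Q] (Θ : Q → ℝ) (f : Q → Q → ℝ) : ℝ :=
  (Finset.univ : Finset (Finset Q × Finset Q)).sup' Finset.univ_nonempty
    fun AB => |∑ x ∈ AB.1, ∑ y ∈ AB.2, Θ x * Θ y * f x y|

/-- A weighted sum whose weights lie between `0` and `w` is dominated in absolute value by the
`w`-weighted sum over some subset. -/
theorem exists_abs_sum_mul_le {Q : Type*} [Fintype Q] {u w : Q → ℝ} (g : Q → ℝ)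
    (hu : ∀ x, 0 ≤ u x) (huw : ∀ x, u x ≤ w x) :
    ∃ A : Finset Q, |∑ x, u x * g x| ≤ |∑ x ∈ A, w x * g x| := by
  classical
  have key : ∀ h : Q → ℝ,
      ∑ x, u x * h x ≤ ∑ x ∈ Finset.univ.filter (fun x => 0 ≤ h x), w x * h x := by
    intro h
    rw [Finset.sum_filter]
    refine Finset.sum_le_sum fun x _ => ?_
    split_ifs with hx
    · exact mul_le_mul_of_nonneg_right (huw x) hx
    · exact mul_nonpos_of_nonneg_of_nonpos (hu x) (not_le.mp hx).le
  rcases le_total 0 (∑ x, u x * g x) with hs | hs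
  · exact ⟨_, (abs_of_nonneg hs).trans_le ((key g).trans (le_abs_self _))⟩
  · refine ⟨Finset.univ.filter (fun x => 0 ≤ -g x), ?_⟩
    have h := key (fun x => -g x)
    simp only [mul_neg, Finset.sum_neg_distrib] at h
    exact (abs_of_nonpos hs).trans_le (h.trans (neg_le_abs _))

theorem abs_sum_le_disc {Q : Type*} [Fintype Q] (Θ : Q → ℝ) (f : Q → Q → ℝ)
    (A B : Finset Q) : |∑ x ∈ A, ∑ y ∈ B, Θ x * Θ y * f x y| ≤ disc Θ f :=
  Finset.le_sup' (fun AB : Finset Q × Finset Q => |∑ x ∈ AB.1, ∑ y ∈ AB.2, Θ x * Θ y * f x y|)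
    (Finset.mem_univ (A, B))

theorem disc_nonneg {Q : Type*} [Fintype Q] (Θ : Q → ℝ) (f : Q → Q → ℝ) : 0 ≤ disc Θ f :=
  (abs_nonneg _).trans (abs_sum_le_disc Θ f ∅ ∅)

/-- Weights dominated by multiples of `Θ` give bilinear sums bounded by the discrepancy. -/
theorem abs_sum_mul_le_disc {Q : Type*} [Fintype Q] {Θ u v : Q → ℝ} {a b : ℝ} (f : Q → Q → ℝ)
    (ha : 0 ≤ a) (hb : 0 ≤ b) (hu : ∀ x, 0 ≤ u x) (hua : ∀ x, u x ≤ a * Θ x)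
    (hv : ∀ y, 0 ≤ v y) (hvb : ∀ y, v y ≤ b * Θ y) :
    |∑ x, ∑ y, u x * v y * f x y| ≤ a * b * disc Θ f := by
  obtain ⟨A, hA⟩ := exists_abs_sum_mul_le (fun x => ∑ y, v y * f x y) hu hua
  obtain ⟨B, hB⟩ := exists_abs_sum_mul_le (fun y => ∑ x ∈ A, a * Θ x * f x y) hv hvb
  calc |∑ x, ∑ y, u x * v y * f x y|
      = |∑ x, u x * ∑ y, v y * f x y| := by simp only [Finset.mul_sum, mul_assoc]
    _ ≤ |∑ x ∈ A, a * Θ x * ∑ y, v y * f x y| := hA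
    _ = |∑ y, v y * ∑ x ∈ A, a * Θ x * f x y| := by
        simp only [Finset.mul_sum]
        rw [Finset.sum_comm]
        simp only [mul_left_comm]
    _ ≤ |∑ y ∈ B, b * Θ y * ∑ x ∈ A, a * Θ x * f x y| := hB
    _ = |a * b * ∑ x ∈ A, ∑ y ∈ B, Θ x * Θ y * f x y| := by
        simp only [Finset.mul_sum]
        rw [Finset.sum_comm]
        congr 1
        exact Finset.sum_congr rfl fun x _ => Finset.sum_congr rfl fun y _ => by ring
    _ = a * b * |∑ x ∈ A, ∑ y ∈ B, Θ x * Θ y * f x y| := by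
        rw [abs_mul, abs_of_nonneg (mul_nonneg ha hb)]
    _ ≤ a * b * disc Θ f :=
        mul_le_mul_of_nonneg_left (abs_sum_le_disc Θ f A B) (mul_nonneg ha hb)

theorem stmt_14 {Q : Type*} [Fintype Q]
    (Θ : Q → ℝ) (hΘ0 : ∀ z, 0 ≤ Θ z) (hΘ1 : ∑ z, Θ z = 1)
    (f : Q → Q → ℝ) (hf : ∀ x y, f x y = 1 ∨ f x y = -1)
    (P R : Q × Q → ℝ)
    (hP0 : ∀ p, 0 ≤ P p) (hP1 : ∑ p, P p = 1)
    (hR0 : ∀ p, 0 ≤ R p) (hR1 : ∑ p, R p = 1)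
    (CX CY : ℝ) (hCX : 0 ≤ CX) (hCY : 0 ≤ CY)
    (hPd : ∀ x₁ x₂, P (x₁, x₂) ≤ (2:ℝ) ^ CX * Θ x₁ * Θ x₂)
    (hRd : ∀ y₁ y₂, R (y₁, y₂) ≤ (2:ℝ) ^ CY * Θ y₁ * Θ y₂) :
    ∀ C : ℝ, 0 < C →
      |∑ x₁, ∑ x₂, ∑ y₁, ∑ y₂, P (x₁, x₂) * R (y₁, y₂) * f x₁ y₁ * f x₂ y₂|
        ≤ (2:ℝ) ^ (CX + CY + 2 * C) * disc Θ f + 2 * (2:ℝ) ^ (-C) := by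
  intro C hC
  have hfabs : ∀ x y, |f x y| = 1 := fun x y => by rcases hf x y with h | h <;> simp [h]
  have hX : (0 : ℝ) ≤ 2 ^ CX := by positivity
  have hY : (0 : ℝ) ≤ 2 ^ CY := by positivity
  have slice : ∀ x₁ y₁, |∑ x₂, ∑ y₂, P (x₁, x₂) * R (y₁, y₂) * f x₁ y₁ * f x₂ y₂|
      ≤ (2:ℝ) ^ CX * Θ x₁ * ((2:ℝ) ^ CY * Θ y₁) * disc Θ f := by
    intro x₁ y₁
    have h := abs_sum_mul_le_disc f (mul_nonneg hX (hΘ0 x₁)) (mul_nonneg hY (hΘ0 y₁))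
      (fun x₂ => hP0 (x₁, x₂)) (hPd x₁) (fun y₂ => hR0 (y₁, y₂)) (hRd y₁)
    have e : ∑ x₂, ∑ y₂, P (x₁, x₂) * R (y₁, y₂) * f x₁ y₁ * f x₂ y₂
        = f x₁ y₁ * ∑ x₂, ∑ y₂, P (x₁, x₂) * R (y₁, y₂) * f x₂ y₂ := by
      simp only [Finset.mul_sum]
      exact Finset.sum_congr rfl fun x _ => Finset.sum_congr rfl fun y _ => by ring
    rwa [e, abs_mul, hfabs, one_mul]
  calc |∑ x₁, ∑ x₂, ∑ y₁, ∑ y₂, P (x₁, x₂) * R (y₁, y₂) * f x₁ y₁ * f x₂ y₂|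
      = |∑ x₁, ∑ y₁, ∑ x₂, ∑ y₂, P (x₁, x₂) * R (y₁, y₂) * f x₁ y₁ * f x₂ y₂| := by
        congr 1
        exact Finset.sum_congr rfl fun x₁ _ => Finset.sum_comm
    _ ≤ ∑ x₁, ∑ y₁, (2:ℝ) ^ CX * Θ x₁ * ((2:ℝ) ^ CY * Θ y₁) * disc Θ f :=
        (Finset.abs_sum_le_sum_abs _ _).trans <| Finset.sum_le_sum fun x₁ _ =>
          (Finset.abs_sum_le_sum_abs _ _).trans <| Finset.sum_le_sum fun y₁ _ => slice x₁ y₁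
    _ = (2:ℝ) ^ (CX + CY) * disc Θ f := by
        simp only [← Finset.sum_mul, ← Finset.mul_sum, hΘ1, mul_one,
          Real.rpow_add (two_pos : (0 : ℝ) < 2)]
    _ ≤ (2:ℝ) ^ (CX + CY + 2 * C) * disc Θ f :=
        mul_le_mul_of_nonneg_right
          (Real.rpow_le_rpow_of_exponent_le one_le_two (by linarith)) (disc_nonneg Θ f)
    _ ≤ (2:ℝ) ^ (CX + CY + 2 * C) * disc Θ f + 2 * (2:ℝ) ^ (-C) :=
        le_add_of_nonneg_right (by positivity)
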